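/- Let s = 1 - 1/√3 and define f : ℂ → ℂ by f(z) = ((1 - s)·z + s)/(-s·z + (1 + s)). Then for every z ∈ ℂ with |z - 4| = √3 one has -s·z + (1 + s) ≠ 0, and the image of the circle {z : |z - 4| = √3} under f is exactly the circle {z : |z| = 2 + √3}. -/

import Mathlib

open Complex

/-- The Hermitian form of the circle `|w| = 2 + √3` pulls back along the matrix
`!![1-s, s; -s, 1+s]` to a multiple of the form of the circle `|z - 4| = √3`. -/
theorem normSq_sub_mul_normSq_eq {q s : ℝ} (hq : q ^ 2 = 3) (hs : s = 1 - q / 3) (z : ℂ) :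
    normSq ((1 - s) * z + s) - (2 + q) ^ 2 * normSq (-s * z + (1 + s)) =
      -((3 + 2 * q) / 3) * (normSq (z - 4) - q ^ 2) := by
  subst hs
  simp only [normSq_apply, add_re, add_im, sub_re, sub_im, mul_re, mul_im, neg_re, neg_im,
    ofReal_re, ofReal_im, one_re, one_im, re_ofNat, im_ofNat]
  grind

theorem norm_eq_mul_norm_iff {q s : ℝ} (hq₀ : 0 < q) (hq : q ^ 2 = 3) (hs : s = 1 - q / 3)
    (z : ℂ) :
    ‖(1 - s) * z + s‖ = (2 + q) * ‖-s * z + (1 + s)‖ ↔ ‖z - 4‖ = q := by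
  have h := normSq_sub_mul_normSq_eq hq hs z
  simp only [normSq_eq_norm_sq] at h
  rw [← sq_eq_sq₀ (norm_nonneg _) (by positivity), ← sq_eq_sq₀ (norm_nonneg (z - 4)) hq₀.le,
    ← sub_eq_zero, mul_pow, h, mul_eq_zero, sub_eq_zero]
  exact or_iff_right (neg_ne_zero.mpr (by positivity))

theorem denom_ne_zero_of_norm_eq {q s : ℝ} (hq₀ : 0 < q) (hq : q ^ 2 = 3) (hs : s = 1 - q / 3)
    {z : ℂ} (hz : ‖z - 4‖ = q) : -s * z + (1 + s) ≠ 0 := by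
  intro hd
  have hn := (norm_eq_mul_norm_iff hq₀ hq hs z).mpr hz
  rw [hd, norm_zero, mul_zero, norm_eq_zero] at hn
  refine one_ne_zero (α := ℂ) ?_
  linear_combination (s : ℂ) * hn + (1 - s : ℂ) * hd

theorem inverse_denom_ne_zero_of_norm_eq {q s : ℝ} (hq₀ : 0 < q) (hq : q ^ 2 = 3)
    (hs : s = 1 - q / 3) {w : ℂ} (hw : ‖w‖ = 2 + q) : s * w + (1 - s) ≠ 0 := by
  intro hd
  have hs₀ : 0 < s := by nlinarith
  have hsw : (s : ℂ) * w = ((-(q / 3) : ℝ) : ℂ) := by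
    rw [eq_neg_of_add_eq_zero_left hd, hs]
    push_cast
    ring
  have hn := congrArg norm hsw
  rw [norm_mul, norm_real, norm_real, norm_neg, Real.norm_of_nonneg hs₀.le,
    Real.norm_of_nonneg (by positivity), hw, hs] at hn
  nlinarith

/-- With `s = 1 - 1/√3`, the Möbius transformation
`f(z) = ((1-s)z + s)/(-sz + (1+s))` is defined on the circle `|z - 4| = √3`
and maps it exactly onto the circle `|z| = 2 + √3`. -/
theorem three_flower_schwarzian :
    (∀ z : ℂ, ‖z - 4‖ = Real.sqrt 3 →
      -(((1 : ℝ) - 1 / Real.sqrt 3 : ℝ) : ℂ) * z +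
        (1 + (((1 : ℝ) - 1 / Real.sqrt 3 : ℝ) : ℂ)) ≠ 0) ∧
    (fun z : ℂ =>
        ((1 - (((1 : ℝ) - 1 / Real.sqrt 3 : ℝ) : ℂ)) * z +
            (((1 : ℝ) - 1 / Real.sqrt 3 : ℝ) : ℂ)) /
          (-(((1 : ℝ) - 1 / Real.sqrt 3 : ℝ) : ℂ) * z +
            (1 + (((1 : ℝ) - 1 / Real.sqrt 3 : ℝ) : ℂ)))) ''
        {z : ℂ | ‖z - 4‖ = Real.sqrt 3} =
      {z : ℂ | ‖z‖ = 2 + Real.sqrt 3} := by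
  have hq₀ : 0 < Real.sqrt 3 := by positivity
  have hq : Real.sqrt 3 ^ 2 = 3 := Real.sq_sqrt (by norm_num)
  have hs : 1 - 1 / Real.sqrt 3 = 1 - Real.sqrt 3 / 3 := by
    field_simp
    linarith
  generalize 1 - 1 / Real.sqrt 3 = s at hs ⊢
  generalize Real.sqrt 3 = q at hq₀ hq hs ⊢
  refine ⟨fun z hz => denom_ne_zero_of_norm_eq hq₀ hq hs hz, ?_⟩
  ext w
  simp only [Set.mem_image, Set.mem_ofPred_eq]
  constructor
  · rintro ⟨z, hz, rfl⟩
    have hd := denom_ne_zero_of_norm_eq hq₀ hq hs hz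
    rw [norm_div, div_eq_iff (norm_ne_zero_iff.mpr hd)]
    exact (norm_eq_mul_norm_iff hq₀ hq hs z).mpr hz
  · intro hw
    have he := inverse_denom_ne_zero_of_norm_eq hq₀ hq hs hw
    have hnum : (1 - s) * (((1 + s) * w - s) / (s * w + (1 - s))) + s =
        w / (s * w + (1 - s)) := by
      field_simp
      ring
    have hden : -s * (((1 + s) * w - s) / (s * w + (1 - s))) + (1 + s) =
        1 / (s * w + (1 - s)) := by
      field_simp
      ring
    refine ⟨((1 + s) * w - s) / (s * w + (1 - s)), ?_, ?_⟩
    · rw [← norm_eq_mul_norm_iff hq₀ hq hs, hnum, hden, norm_div, norm_div, norm_one, hw,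
        mul_one_div]
    · rw [hnum, hden, div_div_div_cancel_right₀ he, div_one]
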